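/- (RIP under optimal sampling.) Suppose U_kᵀδ_i ≠ 0 for all i and let p* be the sampling distribution with p*_i = ‖U_kᵀδ_i‖₂²/k. Let ω_1,…,ω_m be drawn independently from {1,…,n} with ℙ(ω_j = i) = p*_i, M the associated sampling matrix, and P = diag(p*). For any δ, ε ∈ (0,1), if m ≥ (3/δ²) k log(2k/ε), then with probability at least 1−ε, (1−δ)‖x‖₂² ≤ (1/m)‖M P^{−1/2} x‖₂² ≤ (1+δ)‖x‖₂² for all x ∈ span(U_k). -/

import Mathlib

open Matrix

/-- Euclidean norm of a finite real vector. -/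
noncomputable def norm2 {d : ℕ} (x : Fin d → ℝ) : ℝ := Real.sqrt (∑ j, x j ^ 2)

/-- The sampling matrix `M ∈ ℝ^{m×n}` associated to drawn indices `ω`. -/
def sampMat {n m : ℕ} (ω : Fin m → Fin n) : Matrix (Fin m) (Fin n) ℝ :=
  Matrix.of fun i j => if j = ω i then 1 else 0

/-- `P^{-1/2}` for `P = diag(p)`. -/
noncomputable def pInvSqrt {n : ℕ} (p : Fin n → ℝ) : Matrix (Fin n) (Fin n) ℝ :=
  Matrix.diagonal fun i => (Real.sqrt (p i))⁻¹

/-- The optimal sampling distribution `p*_i = ‖U_kᵀδ_i‖₂²/k`. -/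
noncomputable def pStar {n k : ℕ} (Uk : Matrix (Fin n) (Fin k) ℝ) : Fin n → ℝ :=
  fun i => norm2 (Uk.transpose.mulVec (Pi.single i 1)) ^ 2 / k

section RIPaux
open scoped Matrix.Norms.Operator

/-- Quadratic form `vᵀ M v` as a linear functional of `M`. -/
noncomputable def ripQ {k : ℕ} (v : Fin k → ℝ) : Matrix (Fin k) (Fin k) ℝ →ₗ[ℝ] ℝ where
  toFun M := v ⬝ᵥ (M *ᵥ v)
  map_add' A B := by simp [Matrix.add_mulVec, dotProduct_add]
  map_smul' c A := by simp [Matrix.smul_mulVec, dotProduct_smul]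

lemma ripQ_apply {k : ℕ} (v : Fin k → ℝ) (M : Matrix (Fin k) (Fin k) ℝ) :
    ripQ v M = v ⬝ᵥ (M *ᵥ v) := rfl

lemma rip_trace_mul {k : ℕ} (v : Fin k → ℝ) (M : Matrix (Fin k) (Fin k) ℝ) :
    trace (M * vecMulVec v v) = ripQ v M := by
  rw [ripQ_apply, mul_vecMulVec, trace_vecMulVec, dotProduct_comm]

lemma ripQ_mul_P_mul {k : ℕ} (v : Fin k → ℝ) (M N : Matrix (Fin k) (Fin k) ℝ) :
    ripQ v (M * vecMulVec v v * N) = ripQ v M * ripQ v N := by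
  simp only [ripQ_apply]
  rw [mul_vecMulVec, vecMulVec_mul, vecMulVec_mulVec, ← dotProduct_mulVec]
  simp [mul_comm]

lemma rip_spec {k : ℕ} (N : Matrix (Fin k) (Fin k) ℝ) (hN : N.IsHermitian) (v : Fin k → ℝ) :
    ∃ w : Fin k → ℝ, (∀ i, 0 ≤ w i) ∧
      ∀ q : ℕ, ripQ v (N ^ q) = ∑ i, w i * hN.eigenvalues i ^ q := by
  set U : Matrix (Fin k) (Fin k) ℝ := (hN.eigenvectorUnitary : Matrix (Fin k) (Fin k) ℝ) with hUdef
  refine ⟨fun i => ((star U) *ᵥ v) i ^ 2, fun i => sq_nonneg _, fun q => ?_⟩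
  have h := hN.spectral_theorem
  have h1 : N ^ q = U * diagonal (fun i => hN.eigenvalues i ^ q) * star U := by
    conv_lhs => rw [h]
    rw [← map_pow, diagonal_pow, Unitary.conjStarAlgAut_apply]
    rfl
  have h2 : v ᵥ* U = star U *ᵥ v := by
    rw [star_eq_conjTranspose, conjTranspose_eq_transpose_of_trivial, mulVec_transpose]
  rw [h1, ripQ_apply, ← mulVec_mulVec, ← mulVec_mulVec, dotProduct_mulVec, h2]
  simp only [dotProduct, mulVec_diagonal]
  exact Finset.sum_congr rfl fun i _ => by ring

lemma rip_cheb {k : ℕ} (N : Matrix (Fin k) (Fin k) ℝ) (hN : N.PosSemidef) (v : Fin k → ℝ)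
    (hv : v ⬝ᵥ v = 1) (a b : ℕ) :
    ripQ v (N ^ a) * ripQ v (N ^ b) ≤ ripQ v (N ^ (a + b)) := by
  obtain ⟨w, hw, h⟩ := rip_spec N hN.isHermitian v
  have h0 : ∑ i, w i = 1 := by
    have := h 0
    simp [ripQ_apply, hv] at this
    exact this.symm
  rw [h, h, h]
  set l := hN.isHermitian.eigenvalues
  have hl : ∀ i, 0 ≤ l i := hN.eigenvalues_nonneg
  have key : 0 ≤ ∑ i, ∑ j, w i * w j * ((l i ^ a - l j ^ a) * (l i ^ b - l j ^ b)) := by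
    refine Finset.sum_nonneg fun i _ => Finset.sum_nonneg fun j _ =>
      mul_nonneg (mul_nonneg (hw i) (hw j)) ?_
    rcases le_total (l i) (l j) with hh | hh
    · exact mul_nonneg_of_nonpos_of_nonpos
        (sub_nonpos.2 (pow_le_pow_left₀ (hl i) hh a)) (sub_nonpos.2 (pow_le_pow_left₀ (hl i) hh b))
    · exact mul_nonneg
        (sub_nonneg.2 (pow_le_pow_left₀ (hl j) hh a)) (sub_nonneg.2 (pow_le_pow_left₀ (hl j) hh b))
  have e : ∑ i, ∑ j, w i * w j * ((l i ^ a - l j ^ a) * (l i ^ b - l j ^ b)) =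
      (∑ i, w i * l i ^ (a + b)) * (∑ j, w j) + (∑ i, w i) * (∑ j, w j * l j ^ (a + b))
      - (∑ i, w i * l i ^ a) * (∑ j, w j * l j ^ b)
      - (∑ i, w i * l i ^ b) * (∑ j, w j * l j ^ a) := by
    simp only [Finset.sum_mul_sum, ← Finset.sum_add_distrib, ← Finset.sum_sub_distrib]
    exact Finset.sum_congr rfl fun i _ => Finset.sum_congr rfl fun j _ => by ring
  rw [e, h0] at key
  linarith

lemma rip_deriv {k : ℕ} (L : Matrix (Fin k) (Fin k) ℝ →ₗ[ℝ] ℝ)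
    (M B : Matrix (Fin k) (Fin k) ℝ) (q : ℕ) (t : ℝ) :
    HasDerivAt (fun t : ℝ => L ((M + t • B) ^ q))
      (∑ i ∈ Finset.range q, L ((M + t • B) ^ (q.pred - i) * B * (M + t • B) ^ i)) t := by
  have h1 : HasDerivAt (fun t : ℝ => M + t • B) B t := by
    have := ((hasDerivAt_id t).smul_const B).const_add M
    rw [one_smul] at this
    exact this
  have h2 := h1.fun_pow' q
  have h3 := (LinearMap.toContinuousLinearMap L).hasFDerivAt.comp_hasDerivAt t h2
  rw [← map_sum]
  exact h3

lemma rip_P_psd {k : ℕ} (v : Fin k → ℝ) : (vecMulVec v v).PosSemidef := by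
  simpa using posSemidef_vecMulVec_self_star v

lemma rip_Q_psd {k : ℕ} (v : Fin k → ℝ) (hv : v ⬝ᵥ v = 1) :
    (1 - vecMulVec v v : Matrix (Fin k) (Fin k) ℝ).PosSemidef := by
  have hsym : (1 - vecMulVec v v : Matrix (Fin k) (Fin k) ℝ).IsHermitian :=
    isHermitian_one.sub (rip_P_psd v).isHermitian
  have h : (1 - vecMulVec v v : Matrix (Fin k) (Fin k) ℝ) =
      (1 - vecMulVec v v)ᴴ * (1 - vecMulVec v v) := by
    rw [hsym.eq]
    have : vecMulVec v v * vecMulVec v v = vecMulVec v v := by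
      rw [vecMulVec_mul_vecMulVec, hv]; simp
    rw [sub_mul, mul_sub, mul_sub, this]; simp
  rw [h]
  exact posSemidef_conjTranspose_mul_self _

/-- Monotonicity of `vᵀ (M + sQ)^q v`, `Q = I - vvᵀ`. -/
lemma rip_G {k : ℕ} (M : Matrix (Fin k) (Fin k) ℝ) (hM : M.PosSemidef) (v : Fin k → ℝ)
    (hv : v ⬝ᵥ v = 1) (q : ℕ) (s : ℝ) (hs : 0 ≤ s) :
    ripQ v (M ^ q) ≤ ripQ v ((M + s • (1 - vecMulVec v v)) ^ q) := by
  have hmono : MonotoneOn (fun t : ℝ => ripQ v ((M + t • (1 - vecMulVec v v)) ^ q))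
      (Set.Ici 0) := by
    apply monotoneOn_of_deriv_nonneg (convex_Ici 0)
    · exact fun t _ => (rip_deriv _ _ _ q t).continuousAt.continuousWithinAt
    · exact fun t _ => (rip_deriv _ _ _ q t).differentiableAt.differentiableWithinAt
    · intro t ht
      rw [(rip_deriv _ _ _ q t).deriv]
      have ht0 : 0 ≤ t := interior_subset ht
      refine Finset.sum_nonneg fun i hi => ?_
      have hN : (M + t • (1 - vecMulVec v v)).PosSemidef :=
        hM.add ((rip_Q_psd v hv).smul ht0)
      set N := M + t • (1 - vecMulVec v v)
      rw [mul_sub, mul_one, sub_mul, map_sub, ripQ_mul_P_mul, ← pow_add]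
      exact sub_nonneg.2 (rip_cheb N hN v hv _ _)
  simpa using hmono (Set.mem_Ici.2 le_rfl) (Set.mem_Ici.2 hs) hs

lemma rip_trace_deriv {k : ℕ} (M : Matrix (Fin k) (Fin k) ℝ) (v : Fin k → ℝ) (q : ℕ) (t : ℝ) :
    HasDerivAt (fun t : ℝ => trace ((M + t • vecMulVec v v) ^ q))
      (q * ripQ v ((M + t • vecMulVec v v) ^ (q - 1))) t := by
  have h := rip_deriv (traceLinearMap (Fin k) ℝ ℝ) M (vecMulVec v v) q t
  refine h.congr_deriv ?_
  rw [Finset.sum_congr rfl (g := fun _ => ripQ v ((M + t • vecMulVec v v) ^ (q - 1)))]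
  · simp
  · intro i hi
    have := Finset.mem_range.1 hi
    rw [traceLinearMap_apply, Matrix.trace_mul_comm, ← mul_assoc, ← pow_add, rip_trace_mul]
    congr 2
    simp only [Nat.pred_eq_sub_one]; omega

lemma ripQ_scalar_deriv {k : ℕ} (M : Matrix (Fin k) (Fin k) ℝ) (v : Fin k → ℝ) (q : ℕ) (t : ℝ) :
    HasDerivAt (fun t : ℝ => ripQ v ((M + t • (1 : Matrix (Fin k) (Fin k) ℝ)) ^ q))
      (q * ripQ v ((M + t • (1 : Matrix (Fin k) (Fin k) ℝ)) ^ (q - 1))) t := by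
  convert rip_deriv (ripQ v) M 1 q t using 1
  symm
  rw [Finset.sum_congr rfl (g := fun _ => ripQ v ((M + t • (1 : Matrix (Fin k) (Fin k) ℝ)) ^ (q - 1)))]
  · simp
  · intro i hi
    have := Finset.mem_range.1 hi
    rw [mul_one, ← pow_add]
    congr 2
    simp only [Nat.pred_eq_sub_one]; omega

/-- Upward rank-one update. -/
lemma rip_up_pow {k : ℕ} (A : Matrix (Fin k) (Fin k) ℝ) (hA : A.PosSemidef) (v : Fin k → ℝ)
    (hv : v ⬝ᵥ v = 1) (q : ℕ) (s : ℝ) (hs : 0 ≤ s) :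
    trace ((A + s • vecMulVec v v) ^ q) ≤
      trace (A ^ q) + (ripQ v ((A + s • (1 : Matrix (Fin k) (Fin k) ℝ)) ^ q) - ripQ v (A ^ q)) := by
  have hd : ∀ t : ℝ, HasDerivAt (fun t : ℝ =>
      ripQ v ((A + t • (1 : Matrix (Fin k) (Fin k) ℝ)) ^ q) -
        trace ((A + t • vecMulVec v v) ^ q)) _ t :=
    fun t => (ripQ_scalar_deriv A v q t).sub (rip_trace_deriv A v q t)
  have hmono : MonotoneOn (fun t : ℝ =>
      ripQ v ((A + t • (1 : Matrix (Fin k) (Fin k) ℝ)) ^ q) -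
        trace ((A + t • vecMulVec v v) ^ q)) (Set.Ici 0) := by
    apply monotoneOn_of_deriv_nonneg (convex_Ici 0)
    · exact fun t _ => (hd t).continuousAt.continuousWithinAt
    · exact fun t _ => (hd t).differentiableAt.differentiableWithinAt
    · intro t ht
      have ht0 : 0 ≤ t := interior_subset ht
      rw [(hd t).deriv, ← mul_sub]
      refine mul_nonneg (Nat.cast_nonneg _) (sub_nonneg.2 ?_)
      have := rip_G (A + t • vecMulVec v v) (hA.add ((rip_P_psd v).smul ht0)) v hv (q - 1) t ht0
      rwa [smul_sub, add_assoc, add_sub_cancel] at this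
  have := hmono (Set.mem_Ici.2 le_rfl) (Set.mem_Ici.2 hs) hs
  simp at this
  linarith

/-- Downward rank-one update. -/
lemma rip_down_pow {k : ℕ} (A : Matrix (Fin k) (Fin k) ℝ) (hA : A.PosSemidef) (v : Fin k → ℝ)
    (hv : v ⬝ᵥ v = 1) (q : ℕ) (s : ℝ) (hs : 0 ≤ s) :
    trace ((A + s • (1 : Matrix (Fin k) (Fin k) ℝ) + (-s) • vecMulVec v v) ^ q) ≤
      trace ((A + s • (1 : Matrix (Fin k) (Fin k) ℝ)) ^ q) +
        (ripQ v (A ^ q) - ripQ v ((A + s • (1 : Matrix (Fin k) (Fin k) ℝ)) ^ q)) := by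
  set A' := A + s • (1 : Matrix (Fin k) (Fin k) ℝ) with hA'
  have hd : ∀ t : ℝ, HasDerivAt (fun t : ℝ =>
      ripQ v ((A' + t • (1 : Matrix (Fin k) (Fin k) ℝ)) ^ q) -
        trace ((A' + t • vecMulVec v v) ^ q)) _ t :=
    fun t => (ripQ_scalar_deriv A' v q t).sub (rip_trace_deriv A' v q t)
  have hanti : AntitoneOn (fun t : ℝ =>
      ripQ v ((A' + t • (1 : Matrix (Fin k) (Fin k) ℝ)) ^ q) -
        trace ((A' + t • vecMulVec v v) ^ q)) (Set.Icc (-s) 0) := by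
    apply antitoneOn_of_deriv_nonpos (convex_Icc _ 0)
    · exact fun t _ => (hd t).continuousAt.continuousWithinAt
    · exact fun t _ => (hd t).differentiableAt.differentiableWithinAt
    · intro t ht
      obtain ⟨h1, h2⟩ := interior_subset ht
      rw [(hd t).deriv, ← mul_sub]
      refine mul_nonpos_of_nonneg_of_nonpos (Nat.cast_nonneg _) (sub_nonpos.2 ?_)
      have hp : (A' + t • (1 : Matrix (Fin k) (Fin k) ℝ)).PosSemidef := by
        rw [hA', add_assoc, ← add_smul]
        exact hA.add (PosSemidef.one.smul (by linarith))
      have := rip_G _ hp v hv (q - 1) (-t) (by linarith)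
      have e : A' + t • (1 : Matrix (Fin k) (Fin k) ℝ) + -t • (1 - vecMulVec v v) =
          A' + t • vecMulVec v v := by module
      rwa [e] at this
  have := hanti (Set.mem_Icc.2 ⟨le_rfl, by linarith⟩) (Set.mem_Icc.2 ⟨by linarith, le_rfl⟩)
    (by linarith : -s ≤ 0)
  have e : A' + (-s) • (1 : Matrix (Fin k) (Fin k) ℝ) = A := by rw [hA']; module
  simp only [e, zero_smul, add_zero] at this
  linarith

lemma rip_hasSum {k : ℕ} (L : Matrix (Fin k) (Fin k) ℝ →ₗ[ℝ] ℝ) (M : Matrix (Fin k) (Fin k) ℝ) :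
    HasSum (fun q : ℕ => ((q.factorial : ℝ)⁻¹) * L (M ^ q)) (L (NormedSpace.exp M)) := by
  have h := NormedSpace.exp_series_hasSum_exp' (𝕂 := ℝ) M
  have h2 := (LinearMap.toContinuousLinearMap L).hasSum h
  have e : (fun q : ℕ => ((q.factorial : ℝ)⁻¹) * L (M ^ q)) =
      fun q : ℕ => (LinearMap.toContinuousLinearMap L) (((q.factorial : ℝ)⁻¹) • M ^ q) := by
    ext q
    simp
  rw [e]
  exact h2

lemma rip_exp_shift {k : ℕ} (M : Matrix (Fin k) (Fin k) ℝ) (c : ℝ) :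
    NormedSpace.exp (M + c • (1 : Matrix (Fin k) (Fin k) ℝ)) = Real.exp c • NormedSpace.exp M := by
  rw [Matrix.exp_add_of_commute _ _ ((Commute.one_right M).smul_right c)]
  have : NormedSpace.exp (c • (1 : Matrix (Fin k) (Fin k) ℝ)) =
      Real.exp c • (1 : Matrix (Fin k) (Fin k) ℝ) := by
    rw [smul_one_eq_diagonal, exp_diagonal, smul_one_eq_diagonal]
    congr 1
    ext i
    rw [Pi.coe_exp, Real.exp_eq_exp_ℝ]
  rw [this]; simp

lemma rip_trace_pow {k : ℕ} (N : Matrix (Fin k) (Fin k) ℝ) (hN : N.IsHermitian) (q : ℕ) :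
    trace (N ^ q) = ∑ i, hN.eigenvalues i ^ q := by
  conv_lhs => rw [hN.spectral_theorem]
  rw [← map_pow, diagonal_pow, Unitary.conjStarAlgAut_apply, trace_mul_comm, ← mul_assoc]
  simp [trace_diagonal]

lemma rip_trace_exp {k : ℕ} (N : Matrix (Fin k) (Fin k) ℝ) (hN : N.IsHermitian) :
    trace (NormedSpace.exp N) = ∑ i, Real.exp (hN.eigenvalues i) := by
  have h1 := rip_hasSum (traceLinearMap (Fin k) ℝ ℝ) N
  have h2 : HasSum (fun q : ℕ => ∑ i, hN.eigenvalues i ^ q / (q.factorial : ℝ))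
      (∑ i, Real.exp (hN.eigenvalues i)) := by
    refine hasSum_sum fun i _ => ?_
    rw [Real.exp_eq_exp_ℝ]
    exact NormedSpace.expSeries_div_hasSum_exp (hN.eigenvalues i)
  refine h1.unique ?_
  convert h2 using 2 with q
  rw [traceLinearMap_apply, rip_trace_pow N hN, Finset.mul_sum]
  exact Finset.sum_congr rfl fun i _ => by ring

lemma rip_exists_shift {k : ℕ} (N : Matrix (Fin k) (Fin k) ℝ) (hN : N.IsHermitian) :
    ∃ c : ℝ, (N + c • (1 : Matrix (Fin k) (Fin k) ℝ)).PosSemidef := by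
  refine ⟨∑ i, |hN.eigenvalues i|, ?_⟩
  set c := ∑ i, |hN.eigenvalues i|
  refine PosSemidef.of_dotProduct_mulVec_nonneg (hN.add (PosSemidef.one.smul
    (Finset.sum_nonneg fun i _ => abs_nonneg _)).isHermitian) fun x => ?_
  obtain ⟨w, hw, h⟩ := rip_spec N hN x
  have h0 := h 0
  have h1 := h 1
  have : ripQ x (N + c • (1 : Matrix (Fin k) (Fin k) ℝ)) =
      ∑ i, w i * (hN.eigenvalues i + c) := by
    rw [map_add, map_smul, ← pow_zero N, h0]
    rw [pow_one] at h1
    rw [h1, smul_eq_mul, Finset.mul_sum, ← Finset.sum_add_distrib]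
    exact Finset.sum_congr rfl fun i _ => by ring
  change 0 ≤ star x ⬝ᵥ _
  rw [star_trivial, ← ripQ_apply, this]
  refine Finset.sum_nonneg fun i _ => mul_nonneg (hw i) ?_
  have h2 : |hN.eigenvalues i| ≤ c :=
    Finset.single_le_sum (f := fun i => |hN.eigenvalues i|) (fun i _ => abs_nonneg _)
      (Finset.mem_univ i)
  have := neg_abs_le (hN.eigenvalues i)
  linarith

/-- Golden-Thompson for a rank-one perturbation. -/
lemma rip_GT {k : ℕ} (A : Matrix (Fin k) (Fin k) ℝ) (hA : A.IsHermitian) (v : Fin k → ℝ)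
    (hv : v ⬝ᵥ v = 1) (s : ℝ) :
    trace (NormedSpace.exp (A + s • vecMulVec v v)) ≤
      trace (NormedSpace.exp A) + (Real.exp s - 1) * ripQ v (NormedSpace.exp A) := by
  obtain ⟨c, hc⟩ := rip_exists_shift A hA
  have hT := fun M => rip_hasSum (traceLinearMap (Fin k) ℝ ℝ) M
  have hQ := fun M => rip_hasSum (ripQ v) M
  simp only [traceLinearMap_apply] at hT
  rcases le_total 0 s with hs | hs
  · set A' := A + c • (1 : Matrix (Fin k) (Fin k) ℝ) with hA'
    have key := hasSum_le (fun q => by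
        have := mul_le_mul_of_nonneg_left (rip_up_pow A' hc v hv q s hs)
          (inv_nonneg.2 (Nat.cast_nonneg (α := ℝ) q.factorial))
        rwa [mul_add, mul_sub] at this)
      (hT (A' + s • vecMulVec v v))
      ((hT A').add ((hQ (A' + s • (1 : Matrix (Fin k) (Fin k) ℝ))).sub (hQ A')))
    have e : A' + s • vecMulVec v v = A + s • vecMulVec v v +
        c • (1 : Matrix (Fin k) (Fin k) ℝ) := by rw [hA']; module
    rw [e, rip_exp_shift, rip_exp_shift A', hA', rip_exp_shift A] at key
    simp only [trace_smul, map_smul, smul_eq_mul] at key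
    have := Real.exp_pos c
    refine le_of_mul_le_mul_left ?_ this
    linarith
  · set A' := A + c • (1 : Matrix (Fin k) (Fin k) ℝ) with hA'
    have key := hasSum_le (fun q => by
        have := mul_le_mul_of_nonneg_left (rip_down_pow A' hc v hv q (-s) (by linarith))
          (inv_nonneg.2 (Nat.cast_nonneg (α := ℝ) q.factorial))
        rwa [mul_add, mul_sub] at this)
      (hT (A' + (-s) • (1 : Matrix (Fin k) (Fin k) ℝ) + (- -s) • vecMulVec v v))
      ((hT (A' + (-s) • (1 : Matrix (Fin k) (Fin k) ℝ))).add
        ((hQ A').sub (hQ (A' + (-s) • (1 : Matrix (Fin k) (Fin k) ℝ)))))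
    have e : A' + (-s) • (1 : Matrix (Fin k) (Fin k) ℝ) + (- -s) • vecMulVec v v =
        A + s • vecMulVec v v + (c + -s) • (1 : Matrix (Fin k) (Fin k) ℝ) := by
      rw [hA']; module
    have e2 : A' + (-s) • (1 : Matrix (Fin k) (Fin k) ℝ) =
        A + (c + -s) • (1 : Matrix (Fin k) (Fin k) ℝ) := by rw [hA']; module
    rw [e, e2, rip_exp_shift, rip_exp_shift A, hA', rip_exp_shift A] at key
    simp only [trace_smul, map_smul, smul_eq_mul] at key
    have h3 := Real.exp_pos (c + -s)
    have h4 : Real.exp c = Real.exp (c + -s) * Real.exp s := by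
      rw [← Real.exp_add]; congr 1; ring
    rw [h4] at key
    refine le_of_mul_le_mul_left ?_ h3
    linarith

lemma rip_step {n k : ℕ} (hk : 0 < k) (p : Fin n → ℝ) (hp : ∀ i, 0 ≤ p i) (hp1 : ∑ i, p i = 1)
    (v : Fin n → Fin k → ℝ) (hv : ∀ i, v i ⬝ᵥ v i = 1)
    (hI : ∑ i, p i • vecMulVec (v i) (v i) = (k : ℝ)⁻¹ • (1 : Matrix (Fin k) (Fin k) ℝ))
    (A : Matrix (Fin k) (Fin k) ℝ) (hA : A.IsHermitian) (b : ℝ) :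
    ∑ i, p i * trace (NormedSpace.exp (A + b • vecMulVec (v i) (v i))) ≤
      (1 + (Real.exp b - 1) / k) * trace (NormedSpace.exp A) := by
  calc _ ≤ ∑ i, p i * (trace (NormedSpace.exp A) +
        (Real.exp b - 1) * ripQ (v i) (NormedSpace.exp A)) :=
        Finset.sum_le_sum fun i _ => mul_le_mul_of_nonneg_left (rip_GT A hA (v i) (hv i) b) (hp i)
    _ = (∑ i, p i) * trace (NormedSpace.exp A) + (Real.exp b - 1) *
        trace (NormedSpace.exp A * ∑ i, p i • vecMulVec (v i) (v i)) := by
        rw [Finset.mul_sum, trace_sum, Finset.mul_sum, Finset.sum_mul, ← Finset.sum_add_distrib]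
        refine Finset.sum_congr rfl fun i _ => ?_
        rw [mul_smul_comm, trace_smul, rip_trace_mul, smul_eq_mul]; ring
    _ = _ := by
        rw [hp1, hI, mul_smul_comm, trace_smul, mul_one, smul_eq_mul]; ring

lemma rip_mgf {n k : ℕ} (hk : 0 < k) (p : Fin n → ℝ) (hp : ∀ i, 0 ≤ p i) (hp1 : ∑ i, p i = 1)
    (v : Fin n → Fin k → ℝ) (hv : ∀ i, v i ⬝ᵥ v i = 1)
    (hI : ∑ i, p i • vecMulVec (v i) (v i) = (k : ℝ)⁻¹ • (1 : Matrix (Fin k) (Fin k) ℝ))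
    (b : ℝ) (m : ℕ) : ∀ (A : Matrix (Fin k) (Fin k) ℝ), A.IsHermitian →
    ∑ ω : Fin m → Fin n, (∏ j, p (ω j)) *
      trace (NormedSpace.exp (A + ∑ j, b • vecMulVec (v (ω j)) (v (ω j)))) ≤
      (1 + (Real.exp b - 1) / k) ^ m * trace (NormedSpace.exp A) := by
  have hr : 0 ≤ 1 + (Real.exp b - 1) / k := by
    have h1 : (1 : ℝ) ≤ k := by exact_mod_cast hk
    have : 1 + (Real.exp b - 1) / k = ((k - 1) + Real.exp b) / k := by field_simp; ring
    rw [this]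
    have := Real.exp_pos b
    exact div_nonneg (by linarith) (by linarith)
  induction m with
  | zero => intro A hA; simp
  | succ m ih =>
    intro A hA
    rw [← (Fin.consEquiv (fun _ : Fin (m + 1) => Fin n)).sum_comp, Fintype.sum_prod_type]
    calc _ = ∑ i, p i * ∑ ω : Fin m → Fin n, (∏ j, p (ω j)) *
          trace (NormedSpace.exp ((A + b • vecMulVec (v i) (v i)) +
            ∑ j, b • vecMulVec (v (ω j)) (v (ω j)))) := by
          refine Finset.sum_congr rfl fun i _ => ?_
          rw [Finset.mul_sum]
          refine Finset.sum_congr rfl fun ω _ => ?_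
          simp [Fin.consEquiv, Fin.prod_univ_succ, Fin.sum_univ_succ, mul_assoc, add_assoc]
      _ ≤ ∑ i, p i * ((1 + (Real.exp b - 1) / k) ^ m *
          trace (NormedSpace.exp (A + b • vecMulVec (v i) (v i)))) := by
          refine Finset.sum_le_sum fun i _ => mul_le_mul_of_nonneg_left (ih _ ?_) (hp i)
          refine hA.add ?_
          have h := (rip_P_psd (v i)).isHermitian
          rw [IsHermitian, conjTranspose_smul, h.eq, star_trivial]
      _ = (1 + (Real.exp b - 1) / k) ^ m *
          ∑ i, p i * trace (NormedSpace.exp (A + b • vecMulVec (v i) (v i))) := by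
          rw [Finset.mul_sum]
          exact Finset.sum_congr rfl fun i _ => by ring
      _ ≤ (1 + (Real.exp b - 1) / k) ^ m * ((1 + (Real.exp b - 1) / k) *
          trace (NormedSpace.exp A)) :=
          mul_le_mul_of_nonneg_left (rip_step hk p hp hp1 v hv hI A hA b) (pow_nonneg hr m)
      _ = _ := by rw [pow_succ]; ring

lemma rip_trace_exp_nonneg {k : ℕ} (B : Matrix (Fin k) (Fin k) ℝ) (hB : B.IsHermitian) :
    0 ≤ trace (NormedSpace.exp B) := by
  rw [rip_trace_exp B hB]
  exact Finset.sum_nonneg fun i _ => (Real.exp_pos _).le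

lemma rip_trace_exp_ge {k : ℕ} (B : Matrix (Fin k) (Fin k) ℝ) (hB : B.IsHermitian) (c : ℝ)
    (u : Fin k → ℝ) (hu : c * (u ⬝ᵥ u) < ripQ u B) :
    Real.exp c ≤ trace (NormedSpace.exp B) := by
  obtain ⟨w, hw, h⟩ := rip_spec B hB u
  have h0 := h 0
  have h1 := h 1
  simp only [pow_zero, pow_one, mul_one] at h0 h1
  have h00 : ripQ u 1 = u ⬝ᵥ u := by rw [ripQ_apply, one_mulVec]
  rw [← h00, h0, h1, Finset.mul_sum] at hu
  obtain ⟨i, _, hi⟩ := Finset.exists_lt_of_sum_lt hu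
  have hci : c < hB.eigenvalues i := by
    by_contra hcon
    have := mul_le_mul_of_nonneg_left (not_lt.1 hcon) (hw i)
    linarith
  rw [rip_trace_exp B hB]
  exact (Real.exp_le_exp.2 hci.le).trans (Finset.single_le_sum
    (f := fun i => Real.exp (hB.eigenvalues i)) (fun i _ => (Real.exp_pos _).le)
      (Finset.mem_univ i))

open Classical in
lemma rip_tail {n k : ℕ} (hk : 0 < k) (p : Fin n → ℝ) (hp : ∀ i, 0 ≤ p i) (hp1 : ∑ i, p i = 1)
    (v : Fin n → Fin k → ℝ) (hv : ∀ i, v i ⬝ᵥ v i = 1)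
    (hI : ∑ i, p i • vecMulVec (v i) (v i) = (k : ℝ)⁻¹ • (1 : Matrix (Fin k) (Fin k) ℝ))
    (b : ℝ) (m : ℕ) (c : ℝ) :
    ∑ ω : Fin m → Fin n, (if ∃ u : Fin k → ℝ, c * (u ⬝ᵥ u) <
        b * ∑ j, ripQ u (vecMulVec (v (ω j)) (v (ω j))) then ∏ j, p (ω j) else 0) ≤
      Real.exp (-c) * ((1 + (Real.exp b - 1) / k) ^ m * k) := by
  have h := rip_mgf hk p hp hp1 v hv hI b m 0 isHermitian_zero
  have e0 : trace (NormedSpace.exp (0 : Matrix (Fin k) (Fin k) ℝ)) = k := by simp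
  rw [e0] at h
  simp only [zero_add] at h
  refine le_trans ?_ (mul_le_mul_of_nonneg_left h (Real.exp_pos (-c)).le)
  rw [Finset.mul_sum]
  refine Finset.sum_le_sum fun ω _ => ?_
  have hP : 0 ≤ ∏ j, p (ω j) := Finset.prod_nonneg fun j _ => hp _
  have hH : (∑ j, b • vecMulVec (v (ω j)) (v (ω j))).IsHermitian := by
    rw [IsHermitian, conjTranspose_sum]
    refine Finset.sum_congr rfl fun j _ => ?_
    rw [conjTranspose_smul, (rip_P_psd (v (ω j))).isHermitian.eq, star_trivial]
  split_ifs with hb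
  · obtain ⟨u, hu⟩ := hb
    have := rip_trace_exp_ge _ hH c u (by
      rw [map_sum]; simp only [map_smul, smul_eq_mul]; rwa [← Finset.mul_sum])
    have h2 : 1 ≤ Real.exp (-c) * trace (NormedSpace.exp
        (∑ j, b • vecMulVec (v (ω j)) (v (ω j)))) := by
      calc (1 : ℝ) = Real.exp (-c) * Real.exp c := by rw [← Real.exp_add]; simp
        _ ≤ _ := mul_le_mul_of_nonneg_left this (Real.exp_pos _).le
    nlinarith
  · exact mul_nonneg (Real.exp_pos _).le (mul_nonneg hP (rip_trace_exp_nonneg _ hH))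

lemma rip_scalar (d : ℝ) (h0 : -1 < d) (h1 : d < 1) :
    d - (1 + d) * Real.log (1 + d) ≤ - (d ^ 2 / 3) := by
  rcases le_total 0 d with hd | hd
  · have h := Real.le_log_one_add_of_nonneg hd
    have h2 : (1 + d) * (2 * d / (d + 2)) ≤ (1 + d) * Real.log (1 + d) :=
      mul_le_mul_of_nonneg_left h (by linarith)
    have h3 : d + d ^ 2 / 3 ≤ (1 + d) * (2 * d / (d + 2)) := by
      rw [← mul_div_assoc, le_div_iff₀ (by linarith)]
      nlinarith [mul_nonneg hd hd, mul_nonneg (mul_nonneg hd hd) (sub_nonneg.2 h1.le)]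
    linarith
  · have hpos : 0 < 1 + d := by linarith
    have h := Real.sinh_le_self_iff.2 (Real.log_nonpos hpos.le (by linarith))
    rw [Real.sinh_log hpos] at h
    have h2 := mul_le_mul_of_nonneg_left h hpos.le
    have h3 : (1 + d) * ((1 + d - (1 + d)⁻¹) / 2) = ((1 + d) ^ 2 - 1) / 2 := by
      field_simp
    rw [h3] at h2
    nlinarith [sq_nonneg d]

lemma rip_bound {k m : ℕ} (hk : 0 < k) (d ε : ℝ) (h0 : -1 < d) (h1 : d < 1) (hd : d ≠ 0)
    (hε0 : 0 < ε) (hmLB : (3 / d ^ 2) * k * Real.log (2 * k / ε) ≤ m) :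
    Real.exp (-(Real.log (1 + d) * ((1 + d) * m / k))) *
      ((1 + (Real.exp (Real.log (1 + d)) - 1) / k) ^ m * k) ≤ ε / 2 := by
  have hk' : (0 : ℝ) < k := by exact_mod_cast hk
  have hm' : (0 : ℝ) ≤ m := Nat.cast_nonneg m
  have hpos : 0 < 1 + d := by linarith
  have hd2 : 0 < d ^ 2 := by positivity
  rw [Real.exp_log hpos]
  have e1 : (1 + (1 + d - 1) / k : ℝ) ^ m ≤ Real.exp (m * (d / k)) := by
    rw [Real.exp_nat_mul]
    have hnn : (0 : ℝ) ≤ 1 + (1 + d - 1) / k := by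
      have hk1 : (1 : ℝ) ≤ k := by exact_mod_cast hk
      have : 1 + (1 + d - 1) / k = (k + d) / k := by field_simp; ring
      rw [this]; exact div_nonneg (by linarith) hk'.le
    refine pow_le_pow_left₀ hnn ?_ m
    have := Real.add_one_le_exp (d / k)
    have e : 1 + (1 + d - 1) / (k : ℝ) = d / k + 1 := by ring
    rw [e]; exact this
  have e2 : Real.log (2 * k / ε) ≤ m / k * (d ^ 2 / 3) := by
    have : Real.log (2 * k / ε) = (3 / d ^ 2 * k * Real.log (2 * k / ε)) / k * (d ^ 2 / 3) := by
      field_simp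
    rw [this]
    gcongr
  calc _ ≤ Real.exp (-(Real.log (1 + d) * ((1 + d) * m / k))) *
        (Real.exp (m * (d / k)) * k) := by gcongr
    _ = Real.exp (m / k * (d - (1 + d) * Real.log (1 + d))) * k := by
        rw [← mul_assoc, ← Real.exp_add]; congr 2; ring
    _ ≤ Real.exp (-Real.log (2 * k / ε)) * k := by
        refine mul_le_mul_of_nonneg_right (Real.exp_le_exp.2 ?_) hk'.le
        have := mul_le_mul_of_nonneg_left (rip_scalar d h0 h1) (div_nonneg hm' hk'.le)
        linarith
    _ = ε / 2 := by
        rw [Real.exp_neg, Real.exp_log (by positivity)]; field_simp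

lemma norm2_sq {d : ℕ} (x : Fin d → ℝ) : norm2 x ^ 2 = ∑ j, x j ^ 2 := by
  rw [norm2, Real.sq_sqrt (Finset.sum_nonneg fun j _ => sq_nonneg _)]

end RIPaux

open Classical in
theorem restricted_isometry_property_optimal (n k m : ℕ) (hn : 0 < n) (hk : 0 < k)
    (hkn : k ≤ n) (hm : 0 < m)
    (Uk : Matrix (Fin n) (Fin k) ℝ) (hU : Uk.transpose * Uk = 1)
    (hUδ : ∀ i : Fin n, Uk.transpose.mulVec (Pi.single i 1) ≠ 0)
    (δ ε : ℝ) (hδ0 : 0 < δ) (hδ1 : δ < 1) (hε0 : 0 < ε) (hε1 : ε < 1)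
    (hmLB : (3 / δ ^ 2) * k * Real.log (2 * k / ε) ≤ m) :
    1 - ε ≤ ∑ ω : Fin m → Fin n,
      if (∀ x : Fin n → ℝ, (∃ α : Fin k → ℝ, x = Uk.mulVec α) →
            (1 - δ) * norm2 x ^ 2 ≤
              (1 / m) * norm2 ((sampMat ω * pInvSqrt (pStar Uk)).mulVec x) ^ 2 ∧
            (1 / m) * norm2 ((sampMat ω * pInvSqrt (pStar Uk)).mulVec x) ^ 2 ≤
              (1 + δ) * norm2 x ^ 2)
      then ∏ j, pStar Uk (ω j) else 0 := by
  have hk' : (0 : ℝ) < k := by exact_mod_cast hk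
  have hm' : (0 : ℝ) < m := by exact_mod_cast hm
  set p := pStar Uk with hpdef
  have hrow : ∀ i, Uk.transpose.mulVec (Pi.single i 1) = Uk i := by
    intro i; ext j; simp
  have hps : ∀ i, k * p i = Uk i ⬝ᵥ Uk i := by
    intro i
    simp only [hpdef, pStar]
    rw [hrow, norm2_sq, mul_div_cancel₀ _ hk'.ne']
    simp only [dotProduct, sq]
  have hppos : ∀ i, 0 < p i := by
    intro i
    have h1 : 0 < Uk i ⬝ᵥ Uk i := by
      have h2 : Uk i ≠ 0 := by rw [← hrow]; exact hUδ i
      have h3 : Uk i ⬝ᵥ Uk i ≠ 0 := fun h => h2 (dotProduct_self_eq_zero.1 h)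
      have h4 : 0 ≤ Uk i ⬝ᵥ Uk i := Finset.sum_nonneg fun j _ => mul_self_nonneg _
      exact lt_of_le_of_ne h4 h3.symm
    rw [← hps] at h1
    exact pos_of_mul_pos_right h1 hk'.le
  set v : Fin n → Fin k → ℝ := fun i => (Real.sqrt (k * p i))⁻¹ • Uk i with hvdef
  have hkp : ∀ i, 0 < k * p i := fun i => mul_pos hk' (hppos i)
  have hs2 : ∀ i, (Real.sqrt (k * p i))⁻¹ * (Real.sqrt (k * p i))⁻¹ = (k * p i)⁻¹ := by
    intro i; rw [← mul_inv, Real.mul_self_sqrt (hkp i).le]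
  have hv : ∀ i, v i ⬝ᵥ v i = 1 := by
    intro i
    simp only [hvdef, smul_dotProduct, dotProduct_smul, smul_eq_mul]
    rw [← mul_assoc, hs2, ← hps, inv_mul_cancel₀ (hkp i).ne']
  have hP : ∀ i, vecMulVec (v i) (v i) = (k * p i)⁻¹ • vecMulVec (Uk i) (Uk i) := by
    intro i
    simp only [hvdef, smul_vecMulVec, vecMulVec_smul, smul_smul, hs2]
  have hUU : ∑ i, vecMulVec (Uk i) (Uk i) = 1 := by
    rw [← hU]; ext a b
    simp [Matrix.sum_apply, vecMulVec_apply, Matrix.mul_apply]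
  have hI : ∑ i, p i • vecMulVec (v i) (v i) =
      (k : ℝ)⁻¹ • (1 : Matrix (Fin k) (Fin k) ℝ) := by
    rw [← hUU, Finset.smul_sum]
    refine Finset.sum_congr rfl fun i _ => ?_
    rw [hP, smul_smul]
    congr 1
    have := (hppos i).ne'
    field_simp
  have hp1 : ∑ i, p i = 1 := by
    have h := congrArg trace hI
    rw [trace_sum, trace_smul, trace_one, Fintype.card_fin, smul_eq_mul,
      inv_mul_cancel₀ hk'.ne'] at h
    simpa [trace_smul, trace_vecMulVec, hv] using h
  have hprob : ∑ ω : Fin m → Fin n, ∏ j, p (ω j) = 1 := by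
    rw [← Fintype.sum_pow, hp1, one_pow]
  have hprod : ∀ ω : Fin m → Fin n, 0 ≤ ∏ j, p (ω j) := fun ω =>
    Finset.prod_nonneg fun j _ => (hppos _).le
  have hnx : ∀ α : Fin k → ℝ, norm2 (Uk.mulVec α) ^ 2 = α ⬝ᵥ α := by
    intro α
    have h1 : norm2 (Uk.mulVec α) ^ 2 = Uk.mulVec α ⬝ᵥ Uk.mulVec α := by
      rw [norm2_sq]; simp only [dotProduct, sq]
    rw [h1, dotProduct_mulVec, vecMul_mulVec, hU, vecMul_one]
  have hform : ∀ (ω : Fin m → Fin n) (α : Fin k → ℝ),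
      norm2 ((sampMat ω * pInvSqrt p).mulVec (Uk.mulVec α)) ^ 2 =
        k * ∑ j, ripQ α (vecMulVec (v (ω j)) (v (ω j))) := by
    intro ω α
    rw [norm2_sq, Finset.mul_sum]
    refine Finset.sum_congr rfl fun j _ => ?_
    have h1 : (sampMat ω * pInvSqrt p).mulVec (Uk.mulVec α) j =
        (Real.sqrt (p (ω j)))⁻¹ * (Uk (ω j) ⬝ᵥ α) := by
      rw [← mulVec_mulVec]
      simp only [pInvSqrt, sampMat]
      simp only [mulVec, dotProduct, of_apply, diagonal_apply]
      simp
    have h2 : ripQ α (vecMulVec (Uk (ω j)) (Uk (ω j))) = (Uk (ω j) ⬝ᵥ α) ^ 2 := by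
      rw [ripQ_apply, vecMulVec_mulVec]
      simp [dotProduct_comm α, sq]
    rw [h1, hP, map_smul, h2, smul_eq_mul, mul_pow, inv_pow, Real.sq_sqrt (hppos _).le]
    have := (hppos (ω j)).ne'
    field_simp
  have hup := (rip_tail hk p (fun i => (hppos i).le) hp1 v hv hI (Real.log (1 + δ)) m
    (Real.log (1 + δ) * ((1 + δ) * m / k))).trans
    (rip_bound hk δ ε (by linarith) hδ1 hδ0.ne' hε0 hmLB)
  have hdn := (rip_tail hk p (fun i => (hppos i).le) hp1 v hv hI (Real.log (1 + -δ)) m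
    (Real.log (1 + -δ) * ((1 + -δ) * m / k))).trans
    (rip_bound hk (-δ) ε (by linarith) (by linarith) (neg_ne_zero.2 hδ0.ne') hε0
      (by rwa [neg_sq]))
  have hl1 : 0 < Real.log (1 + δ) := Real.log_pos (by linarith)
  have hl2 : Real.log (1 + -δ) < 0 := Real.log_neg (by linarith) (by linarith)
  have hpt : ∀ ω : Fin m → Fin n, ∏ j, p (ω j) ≤
      (if (∀ x : Fin n → ℝ, (∃ α : Fin k → ℝ, x = Uk.mulVec α) →
            (1 - δ) * norm2 x ^ 2 ≤
              (1 / m) * norm2 ((sampMat ω * pInvSqrt p).mulVec x) ^ 2 ∧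
            (1 / m) * norm2 ((sampMat ω * pInvSqrt p).mulVec x) ^ 2 ≤
              (1 + δ) * norm2 x ^ 2)
      then ∏ j, p (ω j) else 0) +
      (if ∃ u : Fin k → ℝ, Real.log (1 + δ) * ((1 + δ) * m / k) * (u ⬝ᵥ u) <
        Real.log (1 + δ) * ∑ j, ripQ u (vecMulVec (v (ω j)) (v (ω j)))
        then ∏ j, p (ω j) else 0) +
      (if ∃ u : Fin k → ℝ, Real.log (1 + -δ) * ((1 + -δ) * m / k) * (u ⬝ᵥ u) <
        Real.log (1 + -δ) * ∑ j, ripQ u (vecMulVec (v (ω j)) (v (ω j)))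
        then ∏ j, p (ω j) else 0) := by
    intro ω
    have hw := hprod ω
    by_cases hA : ∃ u : Fin k → ℝ, Real.log (1 + δ) * ((1 + δ) * m / k) * (u ⬝ᵥ u) <
        Real.log (1 + δ) * ∑ j, ripQ u (vecMulVec (v (ω j)) (v (ω j)))
    · rw [if_pos hA]; split_ifs <;> linarith
    by_cases hB : ∃ u : Fin k → ℝ, Real.log (1 + -δ) * ((1 + -δ) * m / k) * (u ⬝ᵥ u) <
        Real.log (1 + -δ) * ∑ j, ripQ u (vecMulVec (v (ω j)) (v (ω j)))
    · rw [if_pos hB]; split_ifs <;> linarith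
    rw [if_pos, if_neg hA, if_neg hB]
    · linarith
    rintro x ⟨α, rfl⟩
    rw [hform, hnx]
    push Not at hA hB
    have hA' := hA α
    have hB' := hB α
    rw [mul_assoc] at hA' hB'
    have hA2 := le_of_mul_le_mul_left hA' hl1
    have hB2 := (mul_le_mul_left_of_neg hl2).1 hB'
    set S := ∑ j, ripQ α (vecMulVec (v (ω j)) (v (ω j)))
    constructor
    · have : (1 - δ) * (α ⬝ᵥ α) = 1 / m * (k * ((1 + -δ) * m / k * (α ⬝ᵥ α))) := by
        field_simp; ring
      rw [this]; gcongr
    · have : (1 + δ) * (α ⬝ᵥ α) = 1 / m * (k * ((1 + δ) * m / k * (α ⬝ᵥ α))) := by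
        field_simp
      rw [this]; gcongr
  have hsum := Finset.sum_le_sum fun (ω : Fin m → Fin n) (_ : ω ∈ Finset.univ) => hpt ω
  rw [hprob, Finset.sum_add_distrib, Finset.sum_add_distrib] at hsum
  linarith
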